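/- arXiv:2001.02097 — 4 statements merged into one kernel-verified Lean document; each statement's English description precedes it below -/
import Mathlib

section
/- For ξ > 1 define ζ(ξ) = ( (3/4)·( ξ·√(ξ² − 1) − log(ξ + √(ξ² − 1)) ) )^{2/3}. Then ζ is differentiable on (1, ∞) and satisfies the differential equation ζ(ξ)·(ζ′(ξ))² = ξ² − 1 for all ξ > 1. -/
open Real

/-- ζ(ξ) = ((3/4)(ξ√(ξ²−1) − arccosh ξ))^(2/3) for ξ > 1. -/
noncomputable def zetaHermite (ξ : ℝ) : ℝ :=
  ((3/4) * (ξ * Real.sqrt (ξ^2 - 1) - Real.log (ξ + Real.sqrt (ξ^2 - 1)))) ^ ((2:ℝ)/3)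

theorem arcosh_lt_mul_sqrt {ξ : ℝ} (hξ : 1 < ξ) : arcosh ξ < ξ * √(ξ ^ 2 - 1) := by
  have hs : 0 < √(ξ ^ 2 - 1) := sqrt_pos.2 (by nlinarith)
  have h := self_lt_sinh_iff.2 (arcosh_pos hξ)
  rw [sinh_arcosh hξ.le] at h
  nlinarith

theorem hasDerivAt_mul_sqrt_sub_arcosh {ξ : ℝ} (hξ : 1 < ξ) :
    HasDerivAt (fun x : ℝ => x * √(x ^ 2 - 1) - arcosh x) (2 * √(ξ ^ 2 - 1)) ξ := by
  have hpos : 0 < ξ ^ 2 - 1 := by nlinarith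
  have hs : 0 < √(ξ ^ 2 - 1) := sqrt_pos.2 hpos
  have hsq : √(ξ ^ 2 - 1) ^ 2 = ξ ^ 2 - 1 := sq_sqrt hpos.le
  have hsqrt := (((hasDerivAt_id' ξ).fun_pow 2).sub_const 1).sqrt hpos.ne'
  refine (((hasDerivAt_id' ξ).fun_mul hsqrt).fun_sub (hasDerivAt_arcosh hξ)).congr_deriv ?_
  field_simp
  push_cast
  linear_combination (-2) * hsq

theorem zetaHermite_eq (ξ : ℝ) :
    zetaHermite ξ = ((3 / 4) * (ξ * √(ξ ^ 2 - 1) - arcosh ξ)) ^ ((2 : ℝ) / 3) := rfl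

theorem hasDerivAt_zetaHermite {ξ : ℝ} (hξ : 1 < ξ) :
    HasDerivAt zetaHermite
      (√(ξ ^ 2 - 1) * ((3 / 4) * (ξ * √(ξ ^ 2 - 1) - arcosh ξ)) ^ (-(1 : ℝ) / 3)) ξ := by
  have hg : 0 < (3 / 4) * (ξ * √(ξ ^ 2 - 1) - arcosh ξ) := by
    linarith [arcosh_lt_mul_sqrt hξ]
  refine (((hasDerivAt_mul_sqrt_sub_arcosh hξ).const_mul (3 / 4)).rpow_const
    (p := 2 / 3) (Or.inl hg.ne')).congr_deriv ?_
  rw [show (2 : ℝ) / 3 - 1 = -1 / 3 by norm_num]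
  ring

/-- ζ is differentiable on (1, ∞) and satisfies ζ (ζ')² = ξ² − 1 there. -/
theorem zetaHermite_ode :
    DifferentiableOn ℝ zetaHermite (Set.Ioi 1) ∧
    ∀ ξ ∈ Set.Ioi (1:ℝ), zetaHermite ξ * (deriv zetaHermite ξ) ^ 2 = ξ ^ 2 - 1 := by
  refine ⟨fun ξ hξ => (hasDerivAt_zetaHermite hξ).differentiableAt.differentiableWithinAt,
    fun ξ (hξ : 1 < ξ) => ?_⟩
  have hg : 0 < (3 / 4) * (ξ * √(ξ ^ 2 - 1) - arcosh ξ) := by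
    linarith [arcosh_lt_mul_sqrt hξ]
  rw [(hasDerivAt_zetaHermite hξ).deriv, zetaHermite_eq, mul_pow, sq_sqrt (by nlinarith),
    ← rpow_mul_natCast hg.le, mul_left_comm, ← rpow_add hg]
  norm_num
end

section
/- Let η > 0 and set ξ = (2/3)·η^{3/2}. Then the improper integral ∫_0^∞ cos(t³/3 + η·t) dt converges (i.e., the limit as T → ∞ of ∫_0^T cos(t³/3 + η·t) dt exists), and lim_{T→∞} ∫_0^T cos(t³/3 + η·t) dt = (1/2)·√(η/3)·∫_ℝ e^{−ξ·cosh θ}·cosh(θ/3) dθ. -/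
open Real Filter

open MeasureTheory

/-- The integrand `exp (i ξ sinh z) cosh (z / 3)`, which interpolates between the oscillatory
Airy integrand on `ℝ` and the exponentially decaying one on `ℝ + i π / 2`. -/
noncomputable def airyKernel (ξ : ℝ) (z : ℂ) : ℂ :=
  Complex.exp (Complex.I * ξ * Complex.sinh z) * Complex.cosh (z / 3)

theorem differentiable_airyKernel (ξ : ℝ) : Differentiable ℂ (airyKernel ξ) := by
  unfold airyKernel
  fun_prop

theorem airyKernel_add_mul_I (ξ x y : ℝ) :
    airyKernel ξ (x + y * Complex.I) =
      Complex.exp (((-ξ * cosh x * sin y : ℝ) : ℂ) + ((ξ * sinh x * cos y : ℝ) : ℂ) * Complex.I) *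
        (((cosh (x / 3) * cos (y / 3) : ℝ) : ℂ) +
          ((sinh (x / 3) * sin (y / 3) : ℝ) : ℂ) * Complex.I) := by
  have hdiv : ((x : ℂ) + y * Complex.I) / 3 = (x / 3 : ℂ) + (y / 3 : ℂ) * Complex.I := by ring
  rw [airyKernel, hdiv, Complex.sinh_add, Complex.cosh_add]
  simp only [Complex.sinh_mul_I, Complex.cosh_mul_I]
  push_cast
  congr 1
  · congr 1
    linear_combination (ξ * Complex.cosh x * Complex.sin y) * Complex.I_sq
  · ring

theorem re_airyKernel_ofReal (ξ x : ℝ) :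
    (airyKernel ξ (x + (0 : ℝ) * Complex.I)).re = cos (ξ * sinh x) * cosh (x / 3) := by
  rw [airyKernel_add_mul_I]
  simp [Complex.exp_re, Complex.exp_im, -Complex.ofReal_mul, -Complex.ofReal_cosh,
    -Complex.ofReal_sinh]

theorem re_airyKernel_add_pi_div_two (ξ x : ℝ) :
    (airyKernel ξ (x + (π / 2 : ℝ) * Complex.I)).re =
      √3 / 2 * (exp (-ξ * cosh x) * cosh (x / 3)) := by
  have h : π / 2 / 3 = π / 6 := by ring
  rw [airyKernel_add_mul_I, h, cos_pi_div_two, sin_pi_div_two, cos_pi_div_six, mul_zero, mul_one,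
    Complex.ofReal_zero, zero_mul, add_zero, ← Complex.ofReal_exp, Complex.re_ofReal_mul]
  simp only [Complex.add_re, Complex.re_ofReal_mul, Complex.ofReal_re, Complex.I_re]
  ring

theorem im_airyKernel_mul_I (ξ y : ℝ) :
    (airyKernel ξ ((0 : ℝ) + y * Complex.I)).im = 0 := by
  rw [airyKernel_add_mul_I]
  simp [Complex.exp_im, -Complex.ofReal_mul, -Complex.ofReal_sin, -Complex.ofReal_cos]

theorem norm_cosh_le_cosh_re (z : ℂ) : ‖Complex.cosh z‖ ≤ cosh z.re := by
  rw [Complex.cosh, norm_div, Real.cosh_eq, Complex.norm_ofNat]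
  gcongr
  refine (norm_add_le _ _).trans_eq ?_
  simp [Complex.norm_exp]

theorem norm_airyKernel_le (ξ x y : ℝ) :
    ‖airyKernel ξ (x + y * Complex.I)‖ ≤ exp (-ξ * cosh x * sin y) * cosh (x / 3) := by
  have h := norm_cosh_le_cosh_re (((x : ℂ) + y * Complex.I) / 3)
  have hre : (((x : ℂ) + y * Complex.I) / 3).re = x / 3 := by simp
  rw [hre] at h
  rw [airyKernel, norm_mul, Complex.norm_exp]
  have hexp : (Complex.I * ξ * Complex.sinh (x + y * Complex.I)).re = -ξ * cosh x * sin y := by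
    have him : (Complex.sinh (x + y * Complex.I)).im = cosh x * sin y := by
      rw [Complex.sinh_add, Complex.sinh_mul_I, Complex.cosh_mul_I, ← Complex.ofReal_cosh,
        ← Complex.ofReal_sinh, ← Complex.ofReal_cos, ← Complex.ofReal_sin]
      simp [-Complex.ofReal_cosh, -Complex.ofReal_sinh, -Complex.ofReal_cos, -Complex.ofReal_sin]
    simp [Complex.mul_re, him]
    ring
  rw [hexp]
  gcongr

theorem continuous_airyKernel_horizontal (ξ y : ℝ) :
    Continuous fun x : ℝ => airyKernel ξ (x + y * Complex.I) :=
  (differentiable_airyKernel ξ).continuous.comp (by fun_prop)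

theorem continuous_airyKernel_vertical (ξ x : ℝ) :
    Continuous fun y : ℝ => airyKernel ξ (x + y * Complex.I) :=
  (differentiable_airyKernel ξ).continuous.comp (by fun_prop)

/-- Real part of Cauchy's theorem for `airyKernel` on the rectangle `[0, V] × [0, π / 2]`. -/
theorem integral_cos_sinh_eq (ξ V : ℝ) :
    ∫ x in (0 : ℝ)..V, cos (ξ * sinh x) * cosh (x / 3) =
      √3 / 2 * (∫ x in (0 : ℝ)..V, exp (-ξ * cosh x) * cosh (x / 3)) +
        (∫ y in (0 : ℝ)..π / 2, airyKernel ξ (V + y * Complex.I)).im := by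
  have hC := Complex.integral_boundary_rect_eq_zero_of_differentiableOn (airyKernel ξ) 0
    (V + (π / 2 : ℝ) * Complex.I) (differentiable_airyKernel ξ).differentiableOn
  have hre : ((V : ℂ) + (π / 2 : ℝ) * Complex.I).re = V := by simp
  have him : ((V : ℂ) + (π / 2 : ℝ) * Complex.I).im = π / 2 := by simp
  rw [hre, him, Complex.zero_re, Complex.zero_im] at hC
  have hC := congrArg Complex.re hC
  simp only [Complex.add_re, Complex.sub_re, smul_eq_mul, Complex.I_mul_re, Complex.zero_re] at hC
  have h1 := Complex.reCLM.intervalIntegral_comp_comm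
    ((continuous_airyKernel_horizontal ξ 0).intervalIntegrable (μ := volume) 0 V)
  have h2 := Complex.reCLM.intervalIntegral_comp_comm
    ((continuous_airyKernel_horizontal ξ (π / 2)).intervalIntegrable (μ := volume) 0 V)
  have h3 := Complex.imCLM.intervalIntegral_comp_comm
    ((continuous_airyKernel_vertical ξ 0).intervalIntegrable (μ := volume) 0 (π / 2))
  simp only [Complex.reCLM_apply, re_airyKernel_ofReal] at h1
  simp only [Complex.reCLM_apply, re_airyKernel_add_pi_div_two,
    intervalIntegral.integral_const_mul] at h2
  simp only [Complex.imCLM_apply, im_airyKernel_mul_I, intervalIntegral.integral_zero] at h3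
  rw [← h1, ← h2, ← h3] at hC
  linarith

theorem norm_integral_airyKernel_vertical_le {ξ : ℝ} (hξ : 0 < ξ) {V : ℝ} :
    ‖∫ y in (0 : ℝ)..π / 2, airyKernel ξ (V + y * Complex.I)‖ ≤
      π / (2 * ξ) * (cosh (V / 3) / cosh V) := by
  have hcosh := cosh_pos V
  have hpi := pi_pos
  set c : ℝ := ξ * cosh V * (2 / π) with hc
  have hcpos : 0 < c := by positivity
  have hbound : ∀ y ∈ Set.Ioc 0 (π / 2),
      ‖airyKernel ξ (V + y * Complex.I)‖ ≤ exp (-c * y) * cosh (V / 3) := by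
    intro y hy
    refine (norm_airyKernel_le ξ V y).trans ?_
    have hsin := mul_le_sin hy.1.le hy.2
    have := mul_le_mul_of_nonneg_left hsin (by positivity : 0 ≤ ξ * cosh V)
    have hexp : exp (-ξ * cosh V * sin y) ≤ exp (-c * y) := exp_le_exp.mpr (by rw [hc]; linarith)
    gcongr
  refine (intervalIntegral.norm_integral_le_of_norm_le (by positivity)
    (Eventually.of_forall hbound)
    (Continuous.intervalIntegrable (by fun_prop) _ _)).trans ?_
  rw [intervalIntegral.integral_mul_const,
    intervalIntegral.integral_comp_mul_left (fun y => exp y) (neg_ne_zero.mpr hcpos.ne'),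
    integral_exp, mul_zero, exp_zero, smul_eq_mul]
  have hle : (-c)⁻¹ * (exp (-c * (π / 2)) - 1) ≤ c⁻¹ := by
    rw [inv_neg]
    nlinarith [inv_pos.mpr hcpos, exp_pos (-c * (π / 2))]
  calc _ ≤ c⁻¹ * cosh (V / 3) := by gcongr
    _ = _ := by rw [hc]; field_simp

theorem tendsto_cosh_div_three_div_cosh :
    Tendsto (fun V : ℝ => cosh (V / 3) / cosh V) atTop (nhds 0) := by
  have hlim : Tendsto (fun V : ℝ => 2 * exp (-(2 / 3 * V))) atTop (nhds 0) := by
    have := tendsto_exp_neg_atTop_nhds_zero.comp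
      (tendsto_id.const_mul_atTop (show (0 : ℝ) < 2 / 3 by norm_num))
    simpa using this.const_mul 2
  refine squeeze_zero' (Eventually.of_forall fun V => by positivity) ?_ hlim
  filter_upwards [eventually_ge_atTop 0] with V hV
  rw [div_le_iff₀ (cosh_pos V)]
  have h1 : cosh (V / 3) ≤ exp (V / 3) := by
    rw [Real.cosh_eq]
    have : exp (-(V / 3)) ≤ exp (V / 3) := exp_le_exp.mpr (by linarith)
    linarith
  have h2 : exp V / 2 ≤ cosh V := by
    rw [Real.cosh_eq]
    linarith [exp_pos (-V)]
  calc cosh (V / 3) ≤ exp (V / 3) := h1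
    _ = 2 * exp (-(2 / 3 * V)) * (exp V / 2) := by
      rw [show V / 3 = -(2 / 3 * V) + V by ring, exp_add]
      ring
    _ ≤ _ := by gcongr

theorem integrable_exp_neg_mul_cosh_mul_cosh {ξ : ℝ} (hξ : 0 < ξ) :
    Integrable fun θ : ℝ => exp (-ξ * cosh θ) * cosh (θ / 3) := by
  have hquad (c : ℝ) : Integrable fun θ : ℝ => exp (-(ξ / 4) * θ ^ 2 + c * θ) := by
    have h := (integrable_cexp_quadratic (b := ((ξ / 4 : ℝ) : ℂ)) (by simpa using hξ) c 0).norm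
    refine h.congr (Eventually.of_forall fun θ => ?_)
    simp [Complex.norm_exp, ← Complex.ofReal_pow]
  refine (((hquad (1 / 3)).add (hquad (-(1 / 3)))).div_const 2).mono'
    (Continuous.aestronglyMeasurable (by fun_prop)) (Eventually.of_forall fun θ => ?_)
  have hcosh : θ ^ 2 / 4 ≤ cosh θ := by
    have h := quadratic_le_exp_of_nonneg (abs_nonneg θ)
    rw [← cosh_abs, Real.cosh_eq]
    have := add_one_le_exp (-|θ|)
    rw [sq_abs] at h
    linarith
  rw [norm_of_nonneg (by positivity), Pi.add_apply, exp_add, exp_add, Real.cosh_eq (θ / 3)]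
  have hexp : exp (-ξ * cosh θ) ≤ exp (-(ξ / 4) * θ ^ 2) :=
    exp_le_exp.mpr (by nlinarith)
  rw [← mul_add, mul_div_assoc, show 1 / 3 * θ = θ / 3 by ring,
    show -(1 / 3) * θ = -(θ / 3) by ring]
  gcongr

theorem tendsto_integral_cos_sinh {ξ : ℝ} (hξ : 0 < ξ) :
    Tendsto (fun V : ℝ => ∫ x in (0 : ℝ)..V, cos (ξ * sinh x) * cosh (x / 3)) atTop
      (nhds (√3 / 4 * ∫ θ : ℝ, exp (-ξ * cosh θ) * cosh (θ / 3))) := by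
  have heven : ∫ θ : ℝ, exp (-ξ * cosh θ) * cosh (θ / 3) =
      2 * ∫ θ in Set.Ioi (0 : ℝ), exp (-ξ * cosh θ) * cosh (θ / 3) := by
    rw [← integral_comp_abs]
    refine integral_congr_ae (Eventually.of_forall fun θ => ?_)
    have : |θ| / 3 = |θ / 3| := by rw [abs_div, abs_of_pos (by norm_num : (0 : ℝ) < 3)]
    simp only [cosh_abs, this]
  have hmain := (intervalIntegral_tendsto_integral_Ioi 0
    (integrable_exp_neg_mul_cosh_mul_cosh hξ).integrableOn tendsto_id).const_mul (√3 / 2)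
  have hside : Tendsto
      (fun V : ℝ => (∫ y in (0 : ℝ)..π / 2, airyKernel ξ (V + y * Complex.I)).im) atTop
      (nhds 0) := by
    refine squeeze_zero_norm (fun V => (Complex.abs_im_le_norm _).trans
      (norm_integral_airyKernel_vertical_le hξ)) ?_
    simpa using tendsto_cosh_div_three_div_cosh.const_mul (π / (2 * ξ))
  have hsum := hmain.add hside
  rw [heven]
  simp only [integral_cos_sinh_eq]
  convert! hsum using 2
  ring

/-- The substitution `t = 2 a sinh (θ / 3)` turns the cubic phase into `sinh θ`. -/
theorem integral_cos_cubic_eq (a V : ℝ) :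
    ∫ t in (0 : ℝ)..2 * a * sinh (V / 3), cos (t ^ 3 / 3 + a ^ 2 * t) =
      2 * a / 3 * ∫ x in (0 : ℝ)..V, cos (2 / 3 * a ^ 3 * sinh x) * cosh (x / 3) := by
  have hderiv : ∀ x ∈ Set.uIcc 0 V,
      HasDerivAt (fun x => 2 * a * sinh (x / 3)) (2 * a * (cosh (x / 3) * (1 / 3))) x :=
    fun x _ => (((hasDerivAt_id x).div_const 3).sinh).const_mul (2 * a)
  have h := intervalIntegral.integral_comp_mul_deriv hderiv (by fun_prop)
    (g := fun t => cos (t ^ 3 / 3 + a ^ 2 * t)) (by fun_prop)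
  simp only [zero_div, sinh_zero, mul_zero] at h
  rw [← h, ← intervalIntegral.integral_const_mul]
  refine intervalIntegral.integral_congr fun x _ => ?_
  have hsinh : sinh x = 4 * sinh (x / 3) ^ 3 + 3 * sinh (x / 3) := by
    rw [← sinh_three_mul]
    congr 1
    ring
  simp only [Function.comp_apply, hsinh]
  ring_nf

theorem tendsto_arsinh_atTop : Tendsto arsinh atTop atTop :=
  sinhOrderIso.symm.tendsto_atTop

/-- For η > 0 and ξ = (2/3)η^(3/2), the improper integral ∫₀^∞ cos(t³/3 + ηt) dt
converges, with value (1/2)√(η/3) ∫_ℝ e^(−ξ cosh θ) cosh(θ/3) dθ (both sides equal π·Ai(η)). -/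
theorem airy_integral_saddle_representation (η : ℝ) (hη : 0 < η) (ξ : ℝ)
    (hξ : ξ = (2/3) * η ^ ((3:ℝ)/2)) :
    Tendsto (fun T : ℝ => ∫ t in (0:ℝ)..T, Real.cos (t^3/3 + η*t)) atTop
      (nhds ((1/2) * Real.sqrt (η/3) *
        ∫ θ : ℝ, Real.exp (-ξ * Real.cosh θ) * Real.cosh (θ/3))) := by
  obtain ⟨a, ha, rfl⟩ : ∃ a : ℝ, 0 < a ∧ η = a ^ 2 := ⟨√η, sqrt_pos.mpr hη, (sq_sqrt hη.le).symm⟩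
  have hξa : ξ = 2 / 3 * a ^ 3 := by
    rw [hξ, ← rpow_natCast, ← rpow_natCast, ← rpow_mul ha.le]
    norm_num
  have hξpos : 0 < ξ := by rw [hξa]; positivity
  have hV : Tendsto (fun T : ℝ => 3 * arsinh (T / (2 * a))) atTop atTop :=
    (tendsto_arsinh_atTop.comp (tendsto_id.atTop_div_const (by positivity))).const_mul_atTop
      (by norm_num)
  have hlim := ((tendsto_integral_cos_sinh hξpos).comp hV).const_mul (2 * a / 3)
  have hconst : 1 / 2 * √(a ^ 2 / 3) = 2 * a / 3 * (√3 / 4) := by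
    rw [sqrt_div (sq_nonneg a), sqrt_sq ha.le]
    have := sq_sqrt (show (0 : ℝ) ≤ 3 by norm_num)
    field_simp
    linarith
  rw [hconst, mul_assoc]
  refine hlim.congr fun T => ?_
  have hT : 2 * a * sinh (3 * arsinh (T / (2 * a)) / 3) = T := by
    rw [mul_div_cancel_left₀ _ (by norm_num), sinh_arsinh]
    field_simp
  simp only [Function.comp_apply, hξa]
  rw [← integral_cos_cubic_eq, hT]
end

section
/- For τ ∈ (0, π) define σ(τ) = arccosh(τ/ sin τ) and ψ(τ) = σ(τ) − sinh(σ(τ))·cos τ (this is the case z = 1 of the phase function). Then lim_{τ → 0⁺} ψ(τ)/τ³ = 4√3/27. -/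
open Real Filter

/-- arccosh x = log(x + √(x² − 1)) for x ≥ 1. -/
noncomputable def arccosh (x : ℝ) : ℝ := Real.log (x + Real.sqrt (x^2 - 1))

open Topology in
/-- A function that agrees with `c * t ^ n` up to order `n + 1` near `0` has leading
coefficient `c`. -/
lemma tendsto_div_pow_of_abs_sub_le {f : ℝ → ℝ} {c C : ℝ} {n : ℕ}
    (h : ∀ t : ℝ, |t| ≤ 1 → |f t - c * t ^ n| ≤ C * |t| ^ (n + 1)) :
    Tendsto (fun t => f t / t ^ n) (𝓝[≠] 0) (𝓝 c) := by
  rw [tendsto_iff_norm_sub_tendsto_zero]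
  have hC : Tendsto (fun t : ℝ => C * |t|) (𝓝[≠] 0) (𝓝 0) := by
    have : Continuous fun t : ℝ => C * |t| := by fun_prop
    simpa using (this.tendsto 0).mono_left nhdsWithin_le_nhds
  refine squeeze_zero' (Eventually.of_forall fun _ => norm_nonneg _) ?_ hC
  have h1 : ∀ᶠ t : ℝ in 𝓝[≠] 0, |t| ≤ 1 :=
    nhdsWithin_le_nhds <| (continuous_abs.tendsto (0 : ℝ)).eventually_le_const (by simp)
  filter_upwards [h1, self_mem_nhdsWithin] with t ht ht0
  have ht0 : t ≠ 0 := ht0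
  have hpos : 0 < |t| ^ n := by positivity
  have heq : f t / t ^ n - c = (f t - c * t ^ n) / t ^ n := by field_simp
  rw [heq, norm_eq_abs, abs_div, abs_pow, div_le_iff₀ hpos, mul_assoc, ← pow_succ']
  exact h t ht

open Topology in
lemma tendsto_sub_sin_div_cube :
    Tendsto (fun t : ℝ => (t - sin t) / t ^ 3) (𝓝[≠] 0) (𝓝 (1 / 6)) := by
  refine tendsto_div_pow_of_abs_sub_le (C := 1 / 100) fun t ht => ?_
  have hle : |t| ^ 5 ≤ |t| ^ 4 := pow_le_pow_of_le_one (abs_nonneg t) ht (by norm_num)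
  rw [abs_sub_comm]
  calc |1 / 6 * t ^ 3 - (t - sin t)| = |sin t - (t - t ^ 3 / 6)| := by congr 1; ring
    _ ≤ |t| ^ 5 / 100 := sin_bound ht
    _ ≤ 1 / 100 * |t| ^ (3 + 1) := by linarith

open Topology in
lemma tendsto_one_sub_cos_div_sq :
    Tendsto (fun t : ℝ => (1 - cos t) / t ^ 2) (𝓝[≠] 0) (𝓝 (1 / 2)) := by
  refine tendsto_div_pow_of_abs_sub_le (C := 5 / 96) fun t ht => ?_
  have h := cos_bound ht
  have hle : |t| ^ 4 ≤ |t| ^ 3 := pow_le_pow_of_le_one (abs_nonneg t) ht (by norm_num)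
  rw [abs_sub_comm]
  calc |1 / 2 * t ^ 2 - (1 - cos t)| = |cos t - (1 - t ^ 2 / 2)| := by congr 1; ring
    _ ≤ |t| ^ 4 * (5 / 96) := h
    _ ≤ 5 / 96 * |t| ^ (2 + 1) := by linarith

open Topology in
lemma tendsto_sinh_sub_div_cube :
    Tendsto (fun t : ℝ => (sinh t - t) / t ^ 3) (𝓝[≠] 0) (𝓝 (1 / 6)) := by
  refine tendsto_div_pow_of_abs_sub_le (C := 5 / 96) fun t ht => ?_
  have h₁ := exp_bound ht (n := 4) (by norm_num)
  have h₂ := exp_bound (x := -t) (by rwa [abs_neg]) (n := 4) (by norm_num)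
  rw [abs_neg] at h₂
  norm_num [Finset.sum_range_succ, Nat.factorial] at h₁ h₂
  rw [abs_le] at h₁ h₂ ⊢
  rw [sinh_eq]
  norm_num
  have h3 : (-t) ^ 3 = -t ^ 3 := by ring
  rw [h3] at h₂
  constructor <;> linarith [h₁.1, h₁.2, h₂.1, h₂.2]

open Topology in
lemma tendsto_sin_div_self :
    Tendsto (fun t : ℝ => sin t / t) (𝓝[≠] 0) (𝓝 1) := by
  have h := (hasDerivAt_iff_tendsto_slope.1 (hasDerivAt_sin 0))
  simpa [slope_fun_def_field] using h

open Topology in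
lemma tendsto_sinh_div_self :
    Tendsto (fun t : ℝ => sinh t / t) (𝓝[≠] 0) (𝓝 1) := by
  have h := (hasDerivAt_iff_tendsto_slope.1 (hasDerivAt_sinh 0))
  simpa [slope_fun_def_field] using h

open Topology in
lemma tendsto_sqrt_div_sin_sq_sub_one_div_self :
    Tendsto (fun t : ℝ => √((t / sin t) ^ 2 - 1) / t) (𝓝[>] 0) (𝓝 √(1 / 3)) := by
  have hle : 𝓝[>] (0 : ℝ) ≤ 𝓝[≠] 0 := nhdsWithin_mono _ fun _ h => ne_of_gt h
  have hsin := tendsto_sin_div_self.mono_left hle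
  have h := ((tendsto_sub_sin_div_cube.mono_left hle).mul (hsin.const_add 1)).mul
    ((hsin.inv₀ one_ne_zero).pow 2)
  have h' := (continuous_sqrt.tendsto _).comp h
  norm_num only at h'
  refine Tendsto.congr' ?_ h'
  filter_upwards [Ioo_mem_nhdsGT pi_pos] with t ht
  have ht0 : 0 < t := ht.1
  have hs : 0 < sin t := sin_pos_of_pos_of_lt_pi ht.1 ht.2
  have hdiv : √((t / sin t) ^ 2 - 1) / t = √(((t / sin t) ^ 2 - 1) / t ^ 2) := by
    rw [sqrt_div' _ (sq_nonneg t), sqrt_sq ht0.le]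
  rw [Function.comp_apply, hdiv]
  congr 1
  field_simp
  ring

/-- For z = 1 the Bessel phase ψ(τ) = σ(τ) − sinh(σ(τ)) cos τ with
σ(τ) = arccosh(τ/sin τ) satisfies ψ(τ)/τ³ → 4√3/27 as τ → 0⁺. -/
theorem bessel_phase_cubic_limit :
    Tendsto (fun τ : ℝ =>
        (arccosh (τ / Real.sin τ) - Real.sinh (arccosh (τ / Real.sin τ)) * Real.cos τ) / τ^3)
      (nhdsWithin 0 (Set.Ioi 0)) (nhds (4 * Real.sqrt 3 / 27)) := by
  have hle : nhdsWithin (0 : ℝ) (Set.Ioi 0) ≤ nhdsWithin 0 {0}ᶜ :=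
    nhdsWithin_mono _ fun _ h => ne_of_gt h
  set σ : ℝ → ℝ := fun τ => arccosh (τ / sin τ)
  have hx : ∀ᶠ τ : ℝ in nhdsWithin 0 (Set.Ioi 0), 1 < τ / sin τ := by
    filter_upwards [Ioo_mem_nhdsGT pi_pos] with τ hτ
    rw [one_lt_div (sin_pos_of_pos_of_lt_pi hτ.1 hτ.2)]
    exact sin_lt hτ.1
  have hsinh : Tendsto (fun τ => sinh (σ τ) / τ) (nhdsWithin 0 (Set.Ioi 0))
      (nhds √(1 / 3)) := by
    refine tendsto_sqrt_div_sin_sq_sub_one_div_self.congr' ?_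
    filter_upwards [hx] with τ hτ
    rw [← sinh_arcosh hτ.le]
    rfl
  have hτ0 : Tendsto (fun τ : ℝ => τ) (nhdsWithin 0 (Set.Ioi 0)) (nhds 0) :=
    tendsto_id.mono_left nhdsWithin_le_nhds
  have hσ0 : Tendsto σ (nhdsWithin 0 (Set.Ioi 0)) (nhdsWithin 0 {0}ᶜ) := by
    refine tendsto_nhdsWithin_iff.2 ⟨?_, hx.mono fun τ hτ => (arcosh_pos hτ).ne'⟩
    have h := hsinh.mul hτ0
    rw [mul_zero] at h
    have h' := (continuous_arsinh.tendsto 0).comp h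
    rw [arsinh_zero] at h'
    refine h'.congr' ?_
    filter_upwards [self_mem_nhdsWithin] with τ hτ
    rw [Function.comp_apply, div_mul_cancel₀ _ (ne_of_gt hτ), arsinh_sinh]
  have hlim := ((hsinh.mul (tendsto_one_sub_cos_div_sq.mono_left hle))).sub
    ((tendsto_sinh_sub_div_cube.comp hσ0).mul
      ((hsinh.mul ((tendsto_sinh_div_self.comp hσ0).inv₀ one_ne_zero)).pow 3))
  have hval : √(1 / 3) * (1 / 2) - 1 / 6 * (√(1 / 3) * 1⁻¹) ^ 3 = 4 * √3 / 27 := by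
    have h3 : √(1 / 3 : ℝ) = √3 / 3 := by
      rw [sqrt_div zero_le_one, sqrt_one, div_eq_div_iff (by positivity) (by norm_num)]
      simp
    have hsq : √3 ^ 2 = (3 : ℝ) := sq_sqrt (by norm_num)
    rw [h3]
    linear_combination (-√3 / 162) * hsq
  rw [hval] at hlim
  refine hlim.congr' ?_
  filter_upwards [hx, self_mem_nhdsWithin] with τ hτ hpos
  have hτ' : τ ≠ 0 := ne_of_gt hpos
  have hs : 0 < σ τ := arcosh_pos hτ
  have hsh : sinh (σ τ) ≠ 0 := (sinh_pos_iff.2 hs).ne'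
  have hs' := hs.ne'
  simp only [Function.comp_apply]
  change _ = (σ τ - sinh (σ τ) * cos τ) / τ ^ 3
  field_simp
  ring
end

section
/- Let arccosh x = log(x + √(x² − 1)) for x ≥ 1. Then lim_{τ → 0⁺} ( arccosh(2τ/ sin τ) − arccosh 2 ) / τ² = √3/9. -/
open Real Filter

theorem tendsto_self_sub_sin_div_cube :
    Tendsto (fun τ : ℝ => (τ - sin τ) / τ ^ 3) (nhdsWithin 0 (Set.Ioi 0)) (nhds (1 / 6)) := by
  have h0 : Tendsto (fun τ : ℝ => τ ^ 2 / 100) (nhdsWithin 0 (Set.Ioi 0)) (nhds 0) := by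
    have : ContinuousAt (fun τ : ℝ => τ ^ 2 / 100) 0 := by fun_prop
    simpa using this.tendsto.mono_left nhdsWithin_le_nhds
  rw [tendsto_iff_dist_tendsto_zero]
  refine squeeze_zero' (Eventually.of_forall fun _ => dist_nonneg) ?_ h0
  filter_upwards [Ioo_mem_nhdsGT (zero_lt_one' ℝ)] with τ hτ
  have hpos : 0 < τ := hτ.1
  have hb := Real.sin_bound (x := τ) (by rw [abs_of_pos hpos]; exact hτ.2.le)
  have heq : (τ - sin τ) / τ ^ 3 - 1 / 6 = -(sin τ - (τ - τ ^ 3 / 6)) / τ ^ 3 := by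
    field_simp
    ring
  rw [Real.dist_eq, heq, abs_div, abs_neg, abs_of_pos (pow_pos hpos 3),
    div_le_iff₀ (pow_pos hpos 3)]
  rw [abs_of_pos hpos] at hb
  linear_combination hb

theorem tendsto_self_div_sin :
    Tendsto (fun τ : ℝ => τ / sin τ) (nhdsWithin 0 (Set.Ioi 0)) (nhds 1) := by
  have h : Tendsto (fun τ : ℝ => (sinc τ)⁻¹) (nhdsWithin 0 (Set.Ioi 0)) (nhds 1) := by
    have := (continuous_sinc.tendsto 0).inv₀ (by simp)
    simp only [sinc_zero, inv_one] at this
    exact this.mono_left nhdsWithin_le_nhds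
  refine h.congr' ?_
  filter_upwards [self_mem_nhdsWithin] with τ hτ
  rw [sinc_of_ne_zero (ne_of_gt hτ), inv_div]

/-- (arccosh(2τ/sin τ) − arccosh 2)/τ² → √3/9 as τ → 0⁺. -/
theorem shifted_contour_quadratic_limit :
    Tendsto (fun τ : ℝ => (arccosh (2*τ / Real.sin τ) - arccosh 2) / τ^2)
      (nhdsWithin 0 (Set.Ioi 0)) (nhds (Real.sqrt 3 / 9)) := by
  have hderiv : HasDerivAt arccosh (√3)⁻¹ 2 := by
    have h := Real.hasDerivAt_arcosh (x := 2) (by norm_num [Set.mem_Ioi])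
    norm_num at h
    exact h
  have hIoo : ∀ᶠ τ : ℝ in nhdsWithin 0 (Set.Ioi 0), 0 < τ ∧ 0 < sin τ ∧ sin τ < τ := by
    filter_upwards [Ioo_mem_nhdsGT Real.pi_pos] with τ hτ
    exact ⟨hτ.1, sin_pos_of_pos_of_lt_pi hτ.1 hτ.2, sin_lt hτ.1⟩
  have hne : ∀ᶠ τ : ℝ in nhdsWithin 0 (Set.Ioi 0), 2 * τ / sin τ ≠ 2 := by
    filter_upwards [hIoo] with τ ⟨_, hs, hlt⟩
    rw [Ne, div_eq_iff hs.ne']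
    linarith
  have harg : Tendsto (fun τ : ℝ => 2 * τ / sin τ) (nhdsWithin 0 (Set.Ioi 0))
      (nhdsWithin 2 {2}ᶜ) := by
    refine tendsto_nhdsWithin_iff.2 ⟨?_, hne⟩
    simpa [mul_div_assoc] using tendsto_self_div_sin.const_mul 2
  have hprod := (hderiv.tendsto_slope.comp harg).mul
    ((tendsto_self_sub_sin_div_cube.mul tendsto_self_div_sin).const_mul 2)
  have hval : (√3)⁻¹ * (2 * (1 / 6 * 1)) = √3 / 9 := by
    have h3 : √3 * √3 = 3 := Real.mul_self_sqrt (by norm_num)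
    field_simp
    linarith
  rw [hval] at hprod
  refine hprod.congr' ?_
  filter_upwards [hIoo, hne] with τ ⟨hpos, hs, _⟩ hτ
  have hfac : 2 * ((τ - sin τ) / τ ^ 3 * (τ / sin τ)) = (2 * τ / sin τ - 2) / τ ^ 2 := by
    field_simp
  rw [Function.comp_apply, slope_def_field, hfac, div_mul_div_cancel₀ (sub_ne_zero.2 hτ)]
end
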